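/- arXiv:math-ph/0507044 — 7 statements merged into one kernel-verified Lean document; each statement's English description precedes it below -/
import Mathlib

section
/- Let d ≥ 1 be an integer, α ∈ (0,2), and let C₂ ≥ C₁ > 0 and C₃ > 0 be constants. For each n ∈ ℕ let S_n : (0,∞) → [0,∞), and let β_n > 0, θ_n > 0, η_n > 0, R_n > C₃ be such that: (i) (1/(4d)) β_n r² ≤ S_n(r) ≤ β_n r² for every r ∈ (0, θ_n/(4d)]; (ii) C₁ r^α ≤ S_n(r) ≤ C₂ r^α for every r ∈ [C₃ η_n, η_n R_n]; and (iii) R_n → ∞ as n → ∞. Then the sequence (θ_n/η_n)_{n∈ℕ} is bounded. -/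
open Filter

/-- A quadratic lower bound at `b` and a quadratic upper bound at `a` with comparable constants,
combined with `r ^ α` scaling at both points, bound `b` by a multiple of `a`. -/
theorem le_const_mul_of_quadratic_of_rpow {α A B D β a b : ℝ} (hα : α < 2) (hA : 0 < A)
    (hB : 0 < B) (hD : 0 < D) (ha : 0 < a) (hb : 0 < b)
    (hlow : A * a ^ α ≤ β * a ^ 2) (hup : 1 / D * β * b ^ 2 ≤ B * b ^ α) :
    b ≤ (D * B / A) ^ (2 - α)⁻¹ * a := by
  have sq_split : ∀ x : ℝ, 0 < x → x ^ 2 = x ^ (2 - α) * x ^ α := fun x hx => by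
    rw [← Real.rpow_add hx, sub_add_cancel, Real.rpow_two]
  have hlow' : A ≤ β * a ^ (2 - α) := by
    rw [sq_split a ha, ← mul_assoc] at hlow
    exact le_of_mul_le_mul_right hlow (Real.rpow_pos_of_pos ha α)
  have hup' : β * b ^ (2 - α) ≤ D * B := by
    rw [sq_split b hb, ← mul_assoc] at hup
    have h := le_of_mul_le_mul_right hup (Real.rpow_pos_of_pos hb α)
    rwa [mul_assoc, one_div, inv_mul_le_iff₀ hD] at h
  have hpa := Real.rpow_pos_of_pos ha (2 - α)
  have hpb := Real.rpow_pos_of_pos hb (2 - α)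
  have hK : 0 < D * B / A := by positivity
  have hγ : 0 < 2 - α := by linarith
  rw [← Real.rpow_le_rpow_iff hb.le (by positivity) hγ,
    Real.mul_rpow (by positivity) ha.le, Real.rpow_inv_rpow hK.le hγ.ne',
    div_mul_eq_mul_div, le_div_iff₀ hA]
  calc b ^ (2 - α) * A ≤ b ^ (2 - α) * (β * a ^ (2 - α)) := by gcongr
    _ = β * b ^ (2 - α) * a ^ (2 - α) := by ring
    _ ≤ D * B * a ^ (2 - α) := by gcongr

/-- **Statement 2.** If a family of structure functions `S n` satisfies a Taylor-type
two-sided bound `β n r² / (4d) ≤ S n r ≤ β n r²` on `(0, θ n / (4d)]` and a scaling-law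
two-sided bound `C₁ rᵅ ≤ S n r ≤ C₂ rᵅ` on `[C₃ η n, η n * R n]` with `R n → ∞`, then
the ratios `θ n / η n` form a bounded sequence. -/
theorem stmt2 (d : ℕ) (hd : 1 ≤ d) (α : ℝ) (hα0 : 0 < α) (hα2 : α < 2)
    (C₁ C₂ C₃ : ℝ) (hC₁ : 0 < C₁) (hC₁₂ : C₁ ≤ C₂) (hC₃ : 0 < C₃)
    (S : ℕ → ℝ → ℝ) (hS : ∀ n, ∀ r : ℝ, 0 < r → 0 ≤ S n r)
    (β θ η R : ℕ → ℝ)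
    (hβ : ∀ n, 0 < β n) (hθ : ∀ n, 0 < θ n) (hη : ∀ n, 0 < η n)
    (hR : ∀ n, C₃ < R n)
    (h1 : ∀ n, ∀ r : ℝ, 0 < r → r ≤ θ n / (4 * d) →
      (1 / (4 * d)) * β n * r ^ 2 ≤ S n r ∧ S n r ≤ β n * r ^ 2)
    (h2 : ∀ n, ∀ r : ℝ, C₃ * η n ≤ r → r ≤ η n * R n →
      C₁ * r ^ α ≤ S n r ∧ S n r ≤ C₂ * r ^ α)
    (h3 : Tendsto R atTop atTop) :
    ∃ M : ℝ, ∀ n, θ n / η n ≤ M := by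
  have hD : (0 : ℝ) < 4 * d := by positivity
  set L : ℝ := (4 * d * C₂ / C₁) ^ (2 - α)⁻¹
  set M : ℝ := max C₃ (L * C₃)
  suffices h : ∀ᶠ n in atTop, θ n / η n ≤ 4 * d * M by
    obtain ⟨K, hK⟩ := (isBoundedUnder_of_eventually_le h).bddAbove_range
    exact ⟨K, fun n => hK ⟨n, rfl⟩⟩
  filter_upwards [h3.eventually_gt_atTop M] with n hn
  have hηn := hη n
  rw [div_le_iff₀ hηn, mul_assoc, ← div_le_iff₀' hD]
  by_contra! hlt
  have hC₃M : C₃ * η n ≤ M * η n := by gcongr; exact le_max_left _ _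
  have hLM : L * C₃ * η n ≤ M * η n := by gcongr; exact le_max_right _ _
  have hMR : M * η n < η n * R n := by rw [mul_comm]; gcongr
  have ha : 0 < C₃ * η n := by positivity
  have haR : C₃ * η n ≤ η n * R n := by linarith
  set b : ℝ := min (η n * R n) (θ n / (4 * d))
  have hMb : M * η n < b := lt_min hMR hlt
  have hb : 0 < b := by linarith
  have key := le_const_mul_of_quadratic_of_rpow hα2 hC₁ (hC₁.trans_le hC₁₂) hD ha hb
    ((h2 n _ le_rfl haR).1.trans (h1 n _ ha (by linarith)).2)
    ((h1 n b hb (min_le_right _ _)).1.trans (h2 n b (by linarith) (min_le_left _ _)).2)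
  change b ≤ L * (C₃ * η n) at key
  linarith
end

section
/- Let d ≥ 1 be an integer, α ∈ (0,2), and let C₂ ≥ C₁ > 0, C₃ > 0, θ₀ > 0 be constants. Suppose for each n ∈ ℕ we have S_n : (0,∞) → [0,∞), β_n > 0, θ_n ≥ θ₀, η_n > 0, R_n > C₃ such that: (i) (1/(4d)) β_n r² ≤ S_n(r) ≤ β_n r² for every r ∈ (0, θ_n/(4d)]; (ii) C₁ r^α ≤ S_n(r) ≤ C₂ r^α for every r ∈ [C₃ η_n, η_n R_n]; and (iii) R_n → ∞ as n → ∞. Then liminf_{n→∞} η_n > 0; in particular the sequence η_n cannot converge to 0. -/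
open Filter

/-- If a function is comparable to `b * r ^ 2` and to `r ^ α` at both `x` and `q * x`, then the ratio
`q` of the two points is bounded in terms of the constants of comparison. -/
lemma mul_rpow_two_sub_le_of_two_scales {α b m C₁ C₂ q x s t : ℝ} (hm : 0 < m)
    (hq : 0 < q) (hx : 0 < x) (hs : C₁ * x ^ α ≤ s) (hs' : s ≤ b * x ^ 2)
    (ht : 1 / m * b * (q * x) ^ 2 ≤ t) (ht' : t ≤ C₂ * (q * x) ^ α) :
    C₁ * q ^ (2 - α) ≤ m * C₂ := by
  have hxα : 0 < x ^ α := Real.rpow_pos_of_pos hx α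
  have hqα : 0 < q ^ α := Real.rpow_pos_of_pos hq α
  have hq2 : q ^ 2 = q ^ α * q ^ (2 - α) := by
    rw [← Real.rpow_add hq, add_sub_cancel, Real.rpow_two]
  rw [Real.mul_rpow hq.le hx.le] at ht'
  refine le_of_mul_le_mul_right ?_ (mul_pos hqα hxα)
  calc C₁ * q ^ (2 - α) * (q ^ α * x ^ α) = q ^ 2 * (C₁ * x ^ α) := by rw [hq2]; ring
    _ ≤ q ^ 2 * (b * x ^ 2) := mul_le_mul_of_nonneg_left (hs.trans hs') (sq_nonneg q)
    _ = m * (1 / m * b * (q * x) ^ 2) := by field_simp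
    _ ≤ m * (C₂ * (q ^ α * x ^ α)) := mul_le_mul_of_nonneg_left (ht.trans ht') hm.le
    _ = m * C₂ * (q ^ α * x ^ α) := by ring

/-- **Statement 3.** If in addition the dissipation scales `θ n` are bounded below by
`θ₀ > 0`, then the scaling-law length scales `η n` have positive lower limit; in
particular `η n` cannot converge to `0`. -/
theorem stmt3 (d : ℕ) (hd : 1 ≤ d) (α : ℝ) (hα0 : 0 < α) (hα2 : α < 2)
    (C₁ C₂ C₃ θ₀ : ℝ) (hC₁ : 0 < C₁) (hC₁₂ : C₁ ≤ C₂) (hC₃ : 0 < C₃) (hθ₀ : 0 < θ₀)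
    (S : ℕ → ℝ → ℝ) (hS : ∀ n, ∀ r : ℝ, 0 < r → 0 ≤ S n r)
    (β θ η R : ℕ → ℝ)
    (hβ : ∀ n, 0 < β n) (hθ : ∀ n, θ₀ ≤ θ n) (hη : ∀ n, 0 < η n)
    (hR : ∀ n, C₃ < R n)
    (h1 : ∀ n, ∀ r : ℝ, 0 < r → r ≤ θ n / (4 * d) →
      (1 / (4 * d)) * β n * r ^ 2 ≤ S n r ∧ S n r ≤ β n * r ^ 2)
    (h2 : ∀ n, ∀ r : ℝ, C₃ * η n ≤ r → r ≤ η n * R n →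
      C₁ * r ^ α ≤ S n r ∧ S n r ≤ C₂ * r ^ α)
    (h3 : Tendsto R atTop atTop) :
    (∃ c : ℝ, 0 < c ∧ ∀ᶠ n in atTop, c ≤ η n) ∧
      ¬ Tendsto η atTop (nhds 0) := by
  have hm : (0 : ℝ) < 4 * d := by
    have : (0 : ℝ) < d := by exact_mod_cast hd
    positivity
  obtain ⟨q, hq_large, hq1⟩ : ∃ q : ℝ, 4 * d * C₂ / C₁ < q ^ (2 - α) ∧ 1 ≤ q :=
    (((tendsto_rpow_atTop (sub_pos.2 hα2)).eventually_gt_atTop _).and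
      (eventually_ge_atTop 1)).exists
  have hq : 0 < q := one_pos.trans_le hq1
  have hc : 0 < θ₀ / (4 * d) / (q * C₃) := by positivity
  have hbound : ∀ᶠ n in atTop, θ₀ / (4 * d) / (q * C₃) ≤ η n := by
    filter_upwards [h3.eventually_ge_atTop (q * C₃)] with n hn
    by_contra! hlt
    rw [lt_div_iff₀ (by positivity)] at hlt
    have hx : 0 < C₃ * η n := mul_pos hC₃ (hη n)
    have hxq : C₃ * η n ≤ q * (C₃ * η n) := le_mul_of_one_le_left hx.le hq1
    have hqθ : q * (C₃ * η n) ≤ θ n / (4 * d) :=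
      calc q * (C₃ * η n) = η n * (q * C₃) := by ring
        _ ≤ θ₀ / (4 * d) := hlt.le
        _ ≤ θ n / (4 * d) := by gcongr; exact hθ n
    have hqR : q * (C₃ * η n) ≤ η n * R n :=
      calc q * (C₃ * η n) = η n * (q * C₃) := by ring
        _ ≤ η n * R n := mul_le_mul_of_nonneg_left hn (hη n).le
    have key := mul_rpow_two_sub_le_of_two_scales hm hq hx
      (h2 n _ le_rfl (hxq.trans hqR)).1 (h1 n _ hx (hxq.trans hqθ)).2
      (h1 n _ (mul_pos hq hx) hqθ).1 (h2 n _ hxq hqR).2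
    rw [div_lt_iff₀ hC₁] at hq_large
    linarith
  refine ⟨⟨_, hc, hbound⟩, fun h => ?_⟩
  exact hc.not_ge (ge_of_tendsto h hbound)
end

section
/- Let d ≥ 1 be an integer, α ∈ (0,2), and let C₂ ≥ C₁ > 0 and C₃ > 0 be constants. For each n ∈ ℕ let S_n : (0,∞) → [0,∞), β_n > 0, γ_n > 0, ν_n > 0, R_n > C₃, and set ε_n = ν_n β_n, η_n = ν_n^{3/4} ε_n^{−1/4}, θ_n = √(β_n/γ_n). Assume: (i) (1/(4d)) β_n r² ≤ S_n(r) ≤ β_n r² for every r ∈ (0, θ_n/(4d)]; (ii) C₁ r^α ≤ S_n(r) ≤ C₂ r^α for every r ∈ [C₃ η_n, η_n R_n]; and (iii) R_n → ∞ as n → ∞. Then there exists a constant c > 0 such that γ_n ≥ c · ε_n^{3/2} · ν_n^{−5/2} for every n ∈ ℕ. -/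
open Filter

theorem exists_pos_forall_le_of_eventually {f : ℕ → ℝ} (hf : ∀ n, 0 < f n) {c : ℝ} (hc : 0 < c)
    (h : ∀ᶠ n in atTop, c ≤ f n) : ∃ c' : ℝ, 0 < c' ∧ ∀ n, c' ≤ f n := by
  obtain ⟨N, hN⟩ := eventually_atTop.1 h
  obtain ⟨m, -, hm⟩ := (Finset.range (N + 1)).exists_min_image f ⟨0, by simp⟩
  refine ⟨min c (f m), lt_min hc (hf m), fun n => ?_⟩
  rcases le_total N n with hn | hn
  · exact (min_le_left _ _).trans (hN n hn)
  · exact (min_le_right _ _).trans (hm n (by simp; omega))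

/-- Quadratic growth and growth of order `α < 2` are incompatible on a pair of scales whose ratio
`K` is large. -/
theorem not_quadratic_and_rpow_growth {α b C₁ C₂ D K r s₁ s₂ : ℝ} (hC₁ : 0 < C₁) (hD : 0 < D)
    (hr : 0 < r) (hK0 : 0 < K) (hK : D * C₂ / C₁ < K ^ (2 - α))
    (h₁ : C₁ * r ^ α ≤ s₁) (h₁' : s₁ ≤ b * r ^ 2)
    (h₂ : 1 / D * b * (K * r) ^ 2 ≤ s₂) (h₂' : s₂ ≤ C₂ * (K * r) ^ α) : False := by
  have hKα : 0 < K ^ α := Real.rpow_pos_of_pos hK0 α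
  have hK2 : K ^ 2 = K ^ (2 - α) * K ^ α := by
    rw [← Real.rpow_add hK0, sub_add_cancel, Real.rpow_two]
  have h3 := h₂.trans h₂'
  rw [Real.mul_rpow hK0.le hr.le, mul_pow, hK2] at h3
  have h4 : b * K ^ (2 - α) * r ^ 2 ≤ D * C₂ * r ^ α := by
    field_simp at h3
    linarith
  have h5 : D * C₂ < K ^ (2 - α) * C₁ := (div_lt_iff₀ hC₁).1 hK
  have h6 : 0 < r ^ α := Real.rpow_pos_of_pos hr α
  have h7 : D * C₂ * r ^ α < K ^ (2 - α) * C₁ * r ^ α := mul_lt_mul_of_pos_right h5 h6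
  have h8 := mul_le_mul_of_nonneg_left (h₁.trans h₁') (Real.rpow_pos_of_pos hK0 (2 - α)).le
  linarith

theorem kolmogorov_sq_mul {v e : ℝ} (hv : 0 < v) (he : 0 < e) :
    (v ^ ((3 : ℝ) / 4) * e ^ (-(1 : ℝ) / 4)) ^ 2 * (e ^ ((3 : ℝ) / 2) * v ^ (-(5 : ℝ) / 2)) =
      e / v := by
  have h1 : (v ^ ((3 : ℝ) / 4)) ^ 2 * v ^ (-(5 : ℝ) / 2) = v⁻¹ := by
    rw [← Real.rpow_mul_natCast hv.le, ← Real.rpow_add hv, ← Real.rpow_neg_one]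
    norm_num
  have h2 : (e ^ (-(1 : ℝ) / 4)) ^ 2 * e ^ ((3 : ℝ) / 2) = e := by
    rw [← Real.rpow_mul_natCast he.le, ← Real.rpow_add he]
    norm_num
  calc _ = ((e ^ (-(1 : ℝ) / 4)) ^ 2 * e ^ ((3 : ℝ) / 2)) *
        ((v ^ ((3 : ℝ) / 4)) ^ 2 * v ^ (-(5 : ℝ) / 2)) := by ring
    _ = e / v := by rw [h1, h2, div_eq_mul_inv]

/-- **Statement 4.** Under a K41-type scaling law with Kolmogorov scale
`η n = ν n ^ (3/4) * ε n ^ (-1/4)` (where `ε n = ν n * β n`) and dissipation scale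
`θ n = √(β n / γ n)`, the mean square second derivatives satisfy
`γ n ≥ c * ε n ^ (3/2) * ν n ^ (-5/2)`. -/
theorem stmt4 (d : ℕ) (hd : 1 ≤ d) (α : ℝ) (hα0 : 0 < α) (hα2 : α < 2)
    (C₁ C₂ C₃ : ℝ) (hC₁ : 0 < C₁) (hC₁₂ : C₁ ≤ C₂) (hC₃ : 0 < C₃)
    (S : ℕ → ℝ → ℝ) (hS : ∀ n, ∀ r : ℝ, 0 < r → 0 ≤ S n r)
    (β γ ν R ε η θ : ℕ → ℝ)
    (hβ : ∀ n, 0 < β n) (hγ : ∀ n, 0 < γ n) (hν : ∀ n, 0 < ν n)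
    (hR : ∀ n, C₃ < R n)
    (hεdef : ∀ n, ε n = ν n * β n)
    (hηdef : ∀ n, η n = ν n ^ ((3 : ℝ) / 4) * ε n ^ (-(1 : ℝ) / 4))
    (hθdef : ∀ n, θ n = Real.sqrt (β n / γ n))
    (h1 : ∀ n, ∀ r : ℝ, 0 < r → r ≤ θ n / (4 * d) →
      (1 / (4 * d)) * β n * r ^ 2 ≤ S n r ∧ S n r ≤ β n * r ^ 2)
    (h2 : ∀ n, ∀ r : ℝ, C₃ * η n ≤ r → r ≤ η n * R n →
      C₁ * r ^ α ≤ S n r ∧ S n r ≤ C₂ * r ^ α)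
    (h3 : Tendsto R atTop atTop) :
    ∃ c : ℝ, 0 < c ∧ ∀ n, c * ε n ^ ((3 : ℝ) / 2) * ν n ^ (-(5 : ℝ) / 2) ≤ γ n := by
  have hε : ∀ n, 0 < ε n := fun n => hεdef n ▸ mul_pos (hν n) (hβ n)
  have hη : ∀ n, 0 < η n := fun n => hηdef n ▸
    mul_pos (Real.rpow_pos_of_pos (hν n) _) (Real.rpow_pos_of_pos (hε n) _)
  have hD : (0 : ℝ) < 4 * d := by
    have : (0 : ℝ) < d := by exact_mod_cast hd
    positivity
  have hC₂ : 0 < C₂ := hC₁.trans_le hC₁₂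
  obtain ⟨K, hK1, hK⟩ : ∃ K : ℝ, 1 ≤ K ∧ 4 * d * C₂ / C₁ < K ^ (2 - α) :=
    ((eventually_ge_atTop 1).and
      ((tendsto_rpow_atTop (by linarith)).eventually_gt_atTop _)).exists
  have hK0 : 0 < K := zero_lt_one.trans_le hK1
  set M : ℝ := 4 * d * (K * C₃)
  have hM : 0 < M := by positivity
  have hX : ∀ n, 0 < ε n ^ ((3 : ℝ) / 2) * ν n ^ (-(5 : ℝ) / 2) := fun n =>
    mul_pos (Real.rpow_pos_of_pos (hε n) _) (Real.rpow_pos_of_pos (hν n) _)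
  have hθ : ∀ᶠ n in atTop, θ n ≤ M * η n := by
    filter_upwards [h3.eventually_ge_atTop (K * C₃)] with n hn
    by_contra! hlt
    have hr : 0 < C₃ * η n := mul_pos hC₃ (hη n)
    have hrK : C₃ * η n ≤ K * (C₃ * η n) := le_mul_of_one_le_left hr.le hK1
    have hKθ : K * (C₃ * η n) ≤ θ n / (4 * d) := by
      rw [le_div_iff₀ hD]
      linarith [show M * η n = K * (C₃ * η n) * (4 * d) by ring]
    have hKR : K * (C₃ * η n) ≤ η n * R n := by
      linarith [mul_le_mul_of_nonneg_left hn (hη n).le]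
    exact not_quadratic_and_rpow_growth hC₁ hD hr hK0 hK
      (h2 n _ le_rfl (hrK.trans hKR)).1 (h1 n _ hr (hrK.trans hKθ)).2
      (h1 n _ (hr.trans_le hrK) hKθ).1 (h2 n _ hrK hKR).2
  obtain ⟨c, hc, h⟩ := exists_pos_forall_le_of_eventually
    (f := fun n => γ n / (ε n ^ ((3 : ℝ) / 2) * ν n ^ (-(5 : ℝ) / 2)))
    (fun n => div_pos (hγ n) (hX n)) (c := 1 / M ^ 2) (by positivity) (by
      filter_upwards [hθ] with n hn
      have hθ0 : 0 ≤ θ n := hθdef n ▸ Real.sqrt_nonneg _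
      have hsq : θ n ^ 2 = β n / γ n := by
        rw [hθdef, Real.sq_sqrt (div_pos (hβ n) (hγ n)).le]
      have hηX := kolmogorov_sq_mul (hν n) (hε n)
      rw [← hηdef, show ε n / ν n = β n by rw [hεdef]; field_simp [(hν n).ne']] at hηX
      have hle := pow_le_pow_left₀ hθ0 hn 2
      rw [hsq, div_le_iff₀ (hγ n), ← hηX, mul_pow] at hle
      have hη2 : 0 < η n ^ 2 := pow_pos (hη n) 2
      rw [div_le_div_iff₀ (by positivity) (hX n)]
      refine le_of_mul_le_mul_left ?_ hη2
      linarith)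
  exact ⟨c, hc, fun n => by rw [mul_assoc]; exact (le_div_iff₀ (hX n)).1 (h n)⟩
end

section
/- Let ν̃₀ > 0 and let R̃₀ : (0, ν̃₀] → [1, ∞) be continuous and strictly decreasing with R̃₀(x) → ∞ as x → 0⁺. Then there exist ν₀ > 0, C₀ > 0, and a strictly decreasing function R₀ : (0, ν₀] → ℝ with R₀(ν) > C₀ for all ν ∈ (0, ν₀] and R₀(ν) → ∞ as ν → 0⁺, such that for every ν ∈ (0, ν₀] and every r > 0 with C₀ ν^{3/4} < r < ν^{3/4} R₀(ν), one has ν r^{−4/3} < ν̃₀ and 1/r > R̃₀(ν r^{−4/3}). -/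
open Filter Set

/-- A strictly increasing continuous function on `[a, ∞)` diverging at infinity has an inverse on
`[g a, ∞)`, which is again strictly increasing and diverges at infinity. -/
theorem StrictMonoOn.exists_inverse_Ici {g : ℝ → ℝ} {a : ℝ} (hmono : StrictMonoOn g (Ici a))
    (hcont : ContinuousOn g (Ici a)) (hlim : Tendsto g atTop atTop) :
    ∃ h : ℝ → ℝ, (∀ y, g a ≤ y → a ≤ h y ∧ g (h y) = y) ∧
      StrictMonoOn h (Ici (g a)) ∧ Tendsto h atTop atTop := by
  have hsurj : ∀ y, ∃ x, g a ≤ y → a ≤ x ∧ g x = y := by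
    intro y
    by_cases hy : g a ≤ y
    · obtain ⟨b, hyb, hab⟩ := ((hlim.eventually_ge_atTop y).and (eventually_ge_atTop a)).exists
      obtain ⟨x, hx, rfl⟩ :=
        intermediate_value_Icc hab (hcont.mono Icc_subset_Ici_self) ⟨hy, hyb⟩
      exact ⟨x, fun _ => ⟨hx.1, rfl⟩⟩
    · exact ⟨a, fun h => absurd h hy⟩
  choose h hh using hsurj
  refine ⟨h, hh, fun y hy z hz hyz => ?_, tendsto_atTop.2 fun M => ?_⟩
  · rw [← hmono.lt_iff_lt (hh y hy).1 (hh z hz).1, (hh y hy).2, (hh z hz).2]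
    exact hyz
  · filter_upwards [eventually_ge_atTop (g a), eventually_ge_atTop (g (max M a))] with y hy hMy
    have hle : max M a ≤ h y := by
      rw [← hmono.le_iff_le (le_max_right M a) (hh y hy).1, (hh y hy).2]
      exact hMy
    exact (le_max_left M a).trans hle

/-- In the scaling `r = ν^(3/4) s`, the viscosity `ν r^(-4/3)` depends only on `s`. -/
theorem mul_rpow_neg_four_thirds {ν s : ℝ} (hν : 0 < ν) (hs : 0 < s) :
    ν * (ν ^ ((3 : ℝ) / 4) * s) ^ (-(4 : ℝ) / 3) = s ^ (-(4 : ℝ) / 3) := by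
  rw [Real.mul_rpow (by positivity) hs.le, ← Real.rpow_mul hν.le, ← mul_assoc]
  norm_num [Real.rpow_neg_one, hν.ne']

/-- **Statement 8.** (Change of variables, "Condition A implies K41".) Given an
admissible region determined by `ν'₀` and `R'₀`, there are `ν₀, C₀ > 0` and a strictly
decreasing `R₀` diverging at `0⁺` such that the K41 range
`C₀ ν^(3/4) < r < ν^(3/4) R₀(ν)` is mapped by `K(ν,r) = (ν r^(-4/3), r⁻¹)` into the
admissible region `{(ν', L) : ν' < ν'₀, L > R'₀(ν')}`. -/
theorem stmt8 (ν'₀ : ℝ) (hν'₀ : 0 < ν'₀) (R'₀ : ℝ → ℝ)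
    (hcont : ContinuousOn R'₀ (Ioc 0 ν'₀))
    (hanti : StrictAntiOn R'₀ (Ioc 0 ν'₀))
    (hge1 : ∀ x ∈ Ioc 0 ν'₀, 1 ≤ R'₀ x)
    (hlim : Tendsto R'₀ (nhdsWithin 0 (Ioi 0)) atTop) :
    ∃ ν₀ : ℝ, 0 < ν₀ ∧ ∃ C₀ : ℝ, 0 < C₀ ∧ ∃ R₀ : ℝ → ℝ,
      StrictAntiOn R₀ (Ioc 0 ν₀) ∧
      (∀ ν ∈ Ioc 0 ν₀, C₀ < R₀ ν) ∧
      Tendsto R₀ (nhdsWithin 0 (Ioi 0)) atTop ∧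
      ∀ ν ∈ Ioc 0 ν₀, ∀ r : ℝ, 0 < r →
        C₀ * ν ^ ((3 : ℝ) / 4) < r → r < ν ^ ((3 : ℝ) / 4) * R₀ ν →
        ν * r ^ (-(4 : ℝ) / 3) < ν'₀ ∧ R'₀ (ν * r ^ (-(4 : ℝ) / 3)) < 1 / r := by
  set C : ℝ := ν'₀ ^ (-(3 : ℝ) / 4) with hC
  have hC0 : 0 < C := by positivity
  have hCν : C ^ (-(4 : ℝ) / 3) = ν'₀ := by
    rw [hC, ← Real.rpow_mul hν'₀.le]
    norm_num
  have hpos : ∀ s ∈ Ici C, 0 < s := fun s hs => hC0.trans_le hs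
  have hφanti : StrictAntiOn (fun s : ℝ => s ^ (-(4 : ℝ) / 3)) (Ici C) := fun s hs t _ hst =>
    Real.rpow_lt_rpow_of_neg (hpos s hs) hst (by norm_num)
  have hφmem : MapsTo (fun s : ℝ => s ^ (-(4 : ℝ) / 3)) (Ici C) (Ioc 0 ν'₀) := fun s hs =>
    ⟨Real.rpow_pos_of_pos (hpos s hs) _,
      (hφanti.antitoneOn self_mem_Ici hs hs).trans_eq hCν⟩
  have hφcont : ContinuousOn (fun s : ℝ => s ^ (-(4 : ℝ) / 3)) (Ici C) :=
    continuousOn_id.rpow_const fun s hs => Or.inl (hpos s hs).ne'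
  set g : ℝ → ℝ := fun s => s * R'₀ (s ^ (-(4 : ℝ) / 3)) with hg
  have hge : ∀ s ∈ Ici C, 1 ≤ R'₀ (s ^ (-(4 : ℝ) / 3)) := fun s hs => hge1 _ (hφmem hs)
  have hgmono : StrictMonoOn g (Ici C) := fun s hs t ht hst =>
    mul_lt_mul'' hst (hanti (hφmem ht) (hφmem hs) (hφanti hs ht hst)) (hpos s hs).le
      (zero_le_one.trans (hge s hs))
  have hgcont : ContinuousOn g (Ici C) := continuousOn_id.mul (hcont.comp hφcont hφmem)
  have hglim : Tendsto g atTop atTop := by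
    refine tendsto_atTop_mono' _ ?_ tendsto_id
    filter_upwards [eventually_ge_atTop C] with s hs
    exact le_mul_of_one_le_right (hpos s hs).le (hge s hs)
  obtain ⟨h, hh, hhmono, hhlim⟩ := hgmono.exists_inverse_Ici hgcont hglim
  have hgC : 0 < g C := mul_pos hC0 (zero_lt_one.trans_le (hge C self_mem_Ici))
  set ν₀ : ℝ := (g C + 1) ^ (-(4 : ℝ) / 3) with hν₀
  have hν₀pos : 0 < ν₀ := by positivity
  have hψν₀ : ν₀ ^ (-(3 : ℝ) / 4) = g C + 1 := by
    rw [hν₀, ← Real.rpow_mul (by positivity)]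
    norm_num
  have hψanti : StrictAntiOn (fun ν : ℝ => ν ^ (-(3 : ℝ) / 4)) (Ioi 0) := fun ν hν μ _ hνμ =>
    Real.rpow_lt_rpow_of_neg hν hνμ (by norm_num)
  have hψ : ∀ ν ∈ Ioc 0 ν₀, g C < ν ^ (-(3 : ℝ) / 4) := fun ν hν => by
    have := hψanti.antitoneOn hν.1 hν₀pos hν.2
    simp only [hψν₀] at this
    linarith
  refine ⟨ν₀, hν₀pos, C, hC0, fun ν => h (ν ^ (-(3 : ℝ) / 4)), ?_, ?_, ?_, ?_⟩
  · exact fun ν hν μ hμ hνμ => hhmono (hψ μ hμ).le (hψ ν hν).le (hψanti hν.1 hμ.1 hνμ)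
  · intro ν hν
    obtain ⟨hle, heq⟩ := hh _ (hψ ν hν).le
    rw [← hgmono.lt_iff_lt self_mem_Ici hle, heq]
    exact hψ ν hν
  · exact hhlim.comp (tendsto_rpow_neg_nhdsGT_zero (by norm_num))
  · intro ν hν r _ hr₁ hr₂
    have hν0 : 0 < ν := hν.1
    have hp : 0 < ν ^ ((3 : ℝ) / 4) := by positivity
    obtain ⟨s, rfl⟩ : ∃ s, r = ν ^ ((3 : ℝ) / 4) * s := ⟨r / ν ^ ((3 : ℝ) / 4), by field_simp⟩
    rw [mul_comm C] at hr₁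
    have hCs : C < s := lt_of_mul_lt_mul_left hr₁ hp.le
    have hs : 0 < s := hC0.trans hCs
    obtain ⟨hle, heq⟩ := hh _ (hψ ν hν).le
    have hgs := hgmono hCs.le hle (lt_of_mul_lt_mul_left hr₂ hp.le)
    rw [heq, neg_div, Real.rpow_neg hν0.le] at hgs
    rw [mul_rpow_neg_four_thirds hν0 hs]
    refine ⟨(hφanti self_mem_Ici hCs.le hCs).trans_eq hCν, ?_⟩
    rw [← div_div, lt_div_iff₀ hs, mul_comm, one_div]
    exact hgs
end

section
/- Let ν₀ > 0, C₀ > 0, and let R₀ : (0, ν₀] → ℝ be continuous and strictly decreasing with R₀(ν) > C₀ for all ν ∈ (0, ν₀] and R₀(ν) → ∞ as ν → 0⁺. Then there exist ν̃₀ > 0 and a nonincreasing function R̃₀ : (0, ν̃₀] → [1, ∞) with R̃₀(x) → ∞ as x → 0⁺, such that for every ν̃ ∈ (0, ν̃₀] and every r̃ ≥ R̃₀(ν̃), the pair ν = ν̃ r̃^{−4/3}, r = 1/r̃ satisfies ν ≤ ν₀ and C₀ ν^{3/4} < r < ν^{3/4} R₀(ν). -/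
open Filter Set

/-- Under `ν = x * s ^ (-4/3)`, the dissipation scale `ν ^ (3/4)` becomes `x ^ (3/4) / s`. -/
lemma mul_rpow_neg_four_thirds_rpow {x s : ℝ} (hx : 0 ≤ x) (hs : 0 < s) :
    (x * s ^ (-(4 : ℝ) / 3)) ^ ((3 : ℝ) / 4) = x ^ ((3 : ℝ) / 4) * (1 / s) := by
  rw [Real.mul_rpow hx (by positivity), ← Real.rpow_mul hs.le]
  norm_num [Real.rpow_neg_one]

lemma rpow_neg_four_thirds_le_one_div {s : ℝ} (hs : 1 ≤ s) :
    s ^ (-(4 : ℝ) / 3) ≤ 1 / s := by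
  rw [one_div, ← Real.rpow_neg_one]
  exact Real.rpow_le_rpow_of_exponent_le hs (by norm_num)

/-- The scales `s` at which `R₀ (1 / s)` dominates `x ^ (-3/4)`, cut off below. -/
def admissibleScales (ν₀ : ℝ) (R₀ : ℝ → ℝ) (x : ℝ) : Set ℝ :=
  {s | 1 ≤ s ∧ 1 / x ≤ s ∧ 1 / s ≤ ν₀ ∧ x ^ (-(3 : ℝ) / 4) ≤ R₀ (1 / s)}

lemma admissibleScales_bddBelow (ν₀ : ℝ) (R₀ : ℝ → ℝ) (x : ℝ) :
    BddBelow (admissibleScales ν₀ R₀ x) :=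
  ⟨1, fun _ hs => hs.1⟩

lemma admissibleScales_nonempty {ν₀ : ℝ} (hν₀ : 0 < ν₀) {R₀ : ℝ → ℝ}
    (hlim : Tendsto R₀ (nhdsWithin 0 (Ioi 0)) atTop) (x : ℝ) :
    (admissibleScales ν₀ R₀ x).Nonempty := by
  have hinv : Tendsto (fun s : ℝ => 1 / s) atTop (nhdsWithin 0 (Ioi 0)) := by
    simpa only [one_div] using tendsto_inv_atTop_nhdsGT_zero (𝕜 := ℝ)
  have hsmall : ∀ᶠ s : ℝ in atTop, 1 / s ≤ ν₀ :=
    (hinv.mono_right nhdsWithin_le_nhds).eventually_le_const hν₀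
  exact ((eventually_ge_atTop 1).and ((eventually_ge_atTop (1 / x)).and
    (hsmall.and ((hlim.comp hinv).eventually_ge_atTop _)))).exists

lemma admissibleScales_subset {ν₀ : ℝ} {R₀ : ℝ → ℝ} {x y : ℝ} (hx : 0 < x) (hxy : x ≤ y) :
    admissibleScales ν₀ R₀ x ⊆ admissibleScales ν₀ R₀ y := fun _ hs =>
  ⟨hs.1, (one_div_le_one_div_of_le hx hxy).trans hs.2.1, hs.2.2.1,
    (Real.rpow_le_rpow_of_nonpos hx hxy (by norm_num)).trans hs.2.2.2⟩

/-- **Statement 9.** (Change of variables, "K41 implies Condition A".) Given a K41 range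
determined by `ν₀`, `C₀` and `R₀`, there are `ν'₀ > 0` and a nonincreasing
`R'₀ : (0, ν'₀] → [1, ∞)` diverging at `0⁺` such that for `ν' ∈ (0, ν'₀]` and
`r' ≥ R'₀(ν')`, the pair `ν = ν' r'^(-4/3)`, `r = 1/r'` lies in the K41 range. -/
theorem stmt9 (ν₀ C₀ : ℝ) (hν₀ : 0 < ν₀) (hC₀ : 0 < C₀) (R₀ : ℝ → ℝ)
    (hcont : ContinuousOn R₀ (Ioc 0 ν₀))
    (hanti : StrictAntiOn R₀ (Ioc 0 ν₀))
    (hgt : ∀ ν ∈ Ioc 0 ν₀, C₀ < R₀ ν)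
    (hlim : Tendsto R₀ (nhdsWithin 0 (Ioi 0)) atTop) :
    ∃ ν'₀ : ℝ, 0 < ν'₀ ∧ ∃ R'₀ : ℝ → ℝ,
      AntitoneOn R'₀ (Ioc 0 ν'₀) ∧
      (∀ x ∈ Ioc 0 ν'₀, 1 ≤ R'₀ x) ∧
      Tendsto R'₀ (nhdsWithin 0 (Ioi 0)) atTop ∧
      ∀ ν' ∈ Ioc 0 ν'₀, ∀ r' : ℝ, R'₀ ν' ≤ r' →
        ν' * r' ^ (-(4 : ℝ) / 3) ≤ ν₀ ∧
        C₀ * (ν' * r' ^ (-(4 : ℝ) / 3)) ^ ((3 : ℝ) / 4) < 1 / r' ∧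
        1 / r' < (ν' * r' ^ (-(4 : ℝ) / 3)) ^ ((3 : ℝ) / 4) * R₀ (ν' * r' ^ (-(4 : ℝ) / 3)) := by
  have hbdd := admissibleScales_bddBelow ν₀ R₀
  have hne := admissibleScales_nonempty hν₀ hlim
  refine ⟨min 1 ((C₀ + 1) ^ (-(4 : ℝ) / 3)), by positivity,
    fun x => sInf (admissibleScales ν₀ R₀ x) + 1, ?_, ?_, ?_, ?_⟩
  · intro x hx y _ hxy
    have := csInf_le_csInf (hbdd y) (hne x) (admissibleScales_subset hx.1 hxy)
    simpa using this
  · intro x _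
    have : 1 ≤ sInf (admissibleScales ν₀ R₀ x) := le_csInf (hne x) fun _ hs => hs.1
    linarith
  · refine tendsto_atTop_mono (fun x => ?_) (tendsto_inv_nhdsGT_zero (𝕜 := ℝ))
    have : 1 / x ≤ sInf (admissibleScales ν₀ R₀ x) := le_csInf (hne x) fun _ hs => hs.2.1
    rw [one_div] at this
    linarith
  · rintro x ⟨hx, hx'⟩ s hs
    obtain ⟨hx1, hxC⟩ := le_min_iff.1 hx'
    obtain ⟨t, ⟨ht1, -, htν, htR⟩, hts⟩ :=
      exists_lt_of_csInf_lt (hne x) ((lt_add_one _).trans_le hs)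
    have ht : 0 < t := one_pos.trans_le ht1
    have hs0 : 0 < s := ht.trans hts
    have hst : 1 / s < 1 / t := one_div_lt_one_div_of_lt ht hts
    have hpos : 0 < x * s ^ (-(4 : ℝ) / 3) := by positivity
    have hle : x * s ^ (-(4 : ℝ) / 3) < 1 / t :=
      ((mul_le_of_le_one_left (by positivity) hx1).trans
        (rpow_neg_four_thirds_le_one_div (ht1.trans hts.le))).trans_lt hst
    have hR : x ^ (-(3 : ℝ) / 4) < R₀ (x * s ^ (-(4 : ℝ) / 3)) :=
      htR.trans_lt (hanti ⟨hpos, hle.le.trans htν⟩ ⟨by positivity, htν⟩ hle)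
    have hs' : 0 < 1 / s := by positivity
    rw [mul_rpow_neg_four_thirds_rpow hx.le hs0]
    refine ⟨hle.le.trans htν, ?_, ?_⟩
    · have hxpow : x ^ ((3 : ℝ) / 4) ≤ (C₀ + 1)⁻¹ := by
        refine (Real.rpow_le_rpow hx.le hxC (by norm_num)).trans_eq ?_
        rw [← Real.rpow_mul (by positivity), ← Real.rpow_neg_one]
        norm_num
      have hC : C₀ * x ^ ((3 : ℝ) / 4) < 1 := by
        refine (mul_le_mul_of_nonneg_left hxpow hC₀.le).trans_lt ?_
        rw [← div_eq_mul_inv, div_lt_one (by positivity)]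
        exact lt_add_one C₀
      rw [← mul_assoc]
      exact mul_lt_of_lt_one_left hs' hC
    · have hone : 1 < x ^ ((3 : ℝ) / 4) * R₀ (x * s ^ (-(4 : ℝ) / 3)) := by
        refine lt_of_eq_of_lt ?_ (mul_lt_mul_of_pos_left hR (by positivity))
        rw [← Real.rpow_add hx]
        norm_num
      rw [mul_right_comm]
      exact lt_mul_of_one_lt_left hs' hone
end

section
/- Let d ≥ 1 be an integer. There exist constants C' ≥ c' > 0, depending only on d, such that for every k = (k₁, …, k_d) ∈ ℝ^d: c' · min(‖k‖², 1) ≤ Σ_{j=1}^{d} ∫_{1/2}^{3/2} |exp(i λ k_j) − 1|² dλ ≤ C' · min(‖k‖², 1), where ‖k‖ is the Euclidean norm of k. -/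
lemma norm_exp_I_mul_sub_one_sq (l t : ℝ) :
    ‖Complex.exp (Complex.I * l * t) - 1‖ ^ 2 = 2 * (1 - Real.cos (t * l)) := by
  have h : Complex.I * l * t = ((t * l : ℝ) : ℂ) * Complex.I := by push_cast; ring
  rw [h, Complex.exp_mul_I, ← Complex.ofReal_cos, ← Complex.ofReal_sin, Complex.sq_norm,
    Complex.normSq_apply]
  simp only [Complex.sub_re, Complex.sub_im, Complex.add_re, Complex.add_im, Complex.mul_re,
    Complex.mul_im, Complex.ofReal_re, Complex.ofReal_im, Complex.I_re, Complex.I_im,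
    Complex.one_re, Complex.one_im]
  nlinarith [Real.sin_sq_add_cos_sq (t * l)]

lemma intervalIntegrable_two_mul_one_sub_cos (t a b : ℝ) :
    IntervalIntegrable (fun l : ℝ => 2 * (1 - Real.cos (t * l))) MeasureTheory.volume a b :=
  Continuous.intervalIntegrable (by fun_prop) a b

lemma integral_two_mul_one_sub_cos_le (t : ℝ) :
    ∫ l in (1 / 2 : ℝ)..(3 / 2 : ℝ), 2 * (1 - Real.cos (t * l)) ≤ 4 * min (t ^ 2) 1 := by
  have h := intervalIntegral.integral_mono_on (a := 1 / 2) (b := 3 / 2)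
    (g := fun _ : ℝ => 4 * min (t ^ 2) 1)
    (by norm_num) (intervalIntegrable_two_mul_one_sub_cos t (1 / 2) (3 / 2))
    (by simp) (fun l hl => ?_)
  · refine h.trans_eq ?_
    rw [intervalIntegral.integral_const, smul_eq_mul]
    norm_num
  · rw [mul_min_of_nonneg _ _ (by norm_num)]
    refine le_min ?_ (by linarith [Real.neg_one_le_cos (t * l)])
    have h₁ := Real.one_sub_sq_div_two_le_cos (x := t * l)
    have h₂ : l ^ 2 ≤ 4 := by nlinarith [hl.1, hl.2]
    nlinarith [mul_le_mul_of_nonneg_left h₂ (sq_nonneg t)]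

lemma le_integral_two_mul_one_sub_cos (t : ℝ) :
    2 / 25 * min (t ^ 2) 1 ≤ ∫ l in (1 / 2 : ℝ)..(3 / 2 : ℝ), 2 * (1 - Real.cos (t * l)) := by
  have hpi := Real.pi_gt_d2
  rcases le_total |t| (2 * Real.pi / 3) with ht | ht
  · have h := intervalIntegral.integral_mono_on (a := 1 / 2) (b := 3 / 2)
      (f := fun _ : ℝ => 2 / 25 * min (t ^ 2) 1)
      (by norm_num) (by simp) (intervalIntegrable_two_mul_one_sub_cos t (1 / 2) (3 / 2))
      (fun l hl => ?_)
    · refine Eq.trans_le ?_ h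
      rw [intervalIntegral.integral_const, smul_eq_mul]
      norm_num
    · have hl₀ : 0 ≤ l := by linarith [hl.1]
      have habs : |t * l| ≤ Real.pi := by
        rw [abs_mul, abs_of_nonneg hl₀]
        nlinarith [mul_le_mul ht hl.2 hl₀ (by positivity)]
      have hcos := Real.cos_le_one_sub_mul_cos_sq habs
      have hpi2 : 4 / 25 ≤ 2 / Real.pi ^ 2 := by
        rw [div_le_div_iff₀ (by norm_num) (by positivity)]
        nlinarith [Real.pi_lt_d2]
      have hl₂ : 1 / 4 ≤ l ^ 2 := by nlinarith [hl.1]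
      have h₁ := mul_le_mul_of_nonneg_right hpi2 (sq_nonneg (t * l))
      have h₂ := mul_le_mul_of_nonneg_left hl₂ (sq_nonneg t)
      have h₃ := min_le_left (t ^ 2) 1
      rw [mul_pow] at *
      linarith
  · have ht₀ : 0 < |t| := by linarith
    have hne : t ≠ 0 := abs_pos.mp ht₀
    have hint : ∫ l in (1 / 2 : ℝ)..(3 / 2 : ℝ), 2 * (1 - Real.cos (t * l)) =
        2 * (1 - t⁻¹ * (Real.sin (t * (3 / 2)) - Real.sin (t * (1 / 2)))) := by
      rw [intervalIntegral.integral_const_mul, intervalIntegral.integral_sub (by simp)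
        (Continuous.intervalIntegrable (by fun_prop) _ _),
        intervalIntegral.integral_comp_mul_left _ hne, integral_cos]
      simp
      norm_num
    have hsin : |Real.sin (t * (3 / 2)) - Real.sin (t * (1 / 2))| ≤ 2 := by
      rw [abs_le]
      constructor <;> linarith [Real.sin_le_one (t * (3 / 2)), Real.sin_le_one (t * (1 / 2)),
        Real.neg_one_le_sin (t * (3 / 2)), Real.neg_one_le_sin (t * (1 / 2))]
    have hle : t⁻¹ * (Real.sin (t * (3 / 2)) - Real.sin (t * (1 / 2))) ≤ 24 / 25 := by
      refine (le_abs_self _).trans ?_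
      rw [abs_mul, abs_inv, inv_mul_le_iff₀ ht₀]
      linarith
    rw [hint]
    linarith [min_le_right (t ^ 2) 1]

lemma min_sum_le_sum_min {ι : Type*} (s : Finset ι) (f : ι → ℝ) (hf : ∀ i ∈ s, 0 ≤ f i) :
    min (∑ i ∈ s, f i) 1 ≤ ∑ i ∈ s, min (f i) 1 := by
  by_cases h : ∃ i ∈ s, 1 ≤ f i
  · obtain ⟨i, hi, h1⟩ := h
    calc min (∑ i ∈ s, f i) 1 ≤ min (f i) 1 := (min_le_right _ _).trans (le_min h1 le_rfl)
      _ ≤ _ := Finset.single_le_sum (f := fun i => min (f i) 1)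
        (fun j hj => le_min (hf j hj) zero_le_one) hi
  · push Not at h
    exact (min_le_left _ _).trans_eq
      (Finset.sum_congr rfl fun i hi => (min_eq_left (h i hi).le).symm)

lemma sum_min_le_card_mul_min_sum {ι : Type*} (s : Finset ι) (f : ι → ℝ)
    (hf : ∀ i ∈ s, 0 ≤ f i) :
    ∑ i ∈ s, min (f i) 1 ≤ s.card * min (∑ i ∈ s, f i) 1 := by
  rw [← nsmul_eq_mul]
  exact Finset.sum_le_card_nsmul _ _ _ fun i hi =>
    min_le_min_right _ (Finset.single_le_sum hf hi)


/-- **Statement 10.** There are constants `C' ≥ c' > 0` depending only on `d` such that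
for every `k ∈ ℝ^d`,
`c' min(‖k‖², 1) ≤ Σ_j ∫_{1/2}^{3/2} |exp(iλk_j) - 1|² dλ ≤ C' min(‖k‖², 1)`. -/
theorem stmt10 (d : ℕ) (hd : 1 ≤ d) :
    ∃ c' C' : ℝ, 0 < c' ∧ c' ≤ C' ∧
      ∀ k : EuclideanSpace ℝ (Fin d),
        c' * min (‖k‖ ^ 2) 1 ≤
          (∑ j : Fin d, ∫ l in (1 / 2 : ℝ)..(3 / 2 : ℝ),
            ‖Complex.exp (Complex.I * l * (k j)) - 1‖ ^ 2) ∧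
        (∑ j : Fin d, ∫ l in (1 / 2 : ℝ)..(3 / 2 : ℝ),
            ‖Complex.exp (Complex.I * l * (k j)) - 1‖ ^ 2) ≤
          C' * min (‖k‖ ^ 2) 1 := by
  have hd' : (1 : ℝ) ≤ d := by exact_mod_cast hd
  refine ⟨2 / 25, 4 * d, by norm_num, by linarith, fun k => ?_⟩
  simp only [norm_exp_I_mul_sub_one_sq, EuclideanSpace.real_norm_sq_eq]
  have hk : ∀ j ∈ Finset.univ, 0 ≤ k j ^ 2 := fun j _ => sq_nonneg (k j)
  constructor
  · calc 2 / 25 * min (∑ j, k j ^ 2) 1 ≤ 2 / 25 * ∑ j, min (k j ^ 2) 1 := by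
          gcongr
          exact min_sum_le_sum_min _ _ hk
      _ = ∑ j, 2 / 25 * min (k j ^ 2) 1 := Finset.mul_sum _ _ _
      _ ≤ _ := Finset.sum_le_sum fun j _ => le_integral_two_mul_one_sub_cos (k j)
  · calc _ ≤ ∑ j, 4 * min (k j ^ 2) 1 :=
          Finset.sum_le_sum fun j _ => integral_two_mul_one_sub_cos_le (k j)
      _ = 4 * ∑ j, min (k j ^ 2) 1 := (Finset.mul_sum _ _ _).symm
      _ ≤ 4 * (d * min (∑ j, k j ^ 2) 1) := by
          gcongr
          simpa using sum_min_le_card_mul_min_sum Finset.univ (fun j => k j ^ 2) hk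
      _ = 4 * d * min (∑ j, k j ^ 2) 1 := (mul_assoc _ _ _).symm
end

section
/- Let f, g : ℝ³ → ℝ³ be smooth vector fields, 1-periodic in each coordinate, with div f = 0 and div g = 0. Let S_g = (Dg + Dgᵀ)/2 denote the symmetric part of the Jacobian of g (the stress tensor), and ((g·∇)g)_i = Σ_j g_j ∂_j g_i. Then ∫_{[0,1]³} Δf(x) · ((g·∇)g)(x) dx = ∫_{[0,1]³} curl f(x) · ( S_g(x) curl g(x) − ((g·∇) curl g)(x) ) dx. In particular, taking f = g, ∫_{[0,1]³} Δf(x) · ((f·∇)f)(x) dx = ∫_{[0,1]³} ⟨ S_f(x) curl f(x), curl f(x) ⟩ dx, i.e. the inner product of the Laplacian with the convective nonlinearity equals the integrated vortex stretching. -/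
open MeasureTheory

noncomputable section

abbrev E3 := EuclideanSpace ℝ (Fin 3)

/-- The partial derivative `∂_j v_i (x)` of a vector field `v : ℝ³ → ℝ³`. -/
def pd (v : E3 → E3) (j i : Fin 3) (x : E3) : ℝ :=
  fderiv ℝ v x (EuclideanSpace.single j 1) i

/-- The curl of a vector field, `(curl v)_i = Σ_{j,k} ε_{ijk} ∂_j v_k`. -/
def curl (v : E3 → E3) (x : E3) : Fin 3 → ℝ :=
  ![pd v 1 2 x - pd v 2 1 x, pd v 2 0 x - pd v 0 2 x, pd v 0 1 x - pd v 1 0 x]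

/-- The componentwise Laplacian `(Δv)_i = Σ_j ∂_j ∂_j v_i`. -/
def lap (v : E3 → E3) (x : E3) (i : Fin 3) : ℝ :=
  ∑ j : Fin 3, fderiv ℝ (fun y => pd v j i y) x (EuclideanSpace.single j 1)

/-- The convective term `((g·∇)g)_i = Σ_j g_j ∂_j g_i`. -/
def conv (g : E3 → E3) (x : E3) (i : Fin 3) : ℝ :=
  ∑ j : Fin 3, g x j * pd g j i x

/-- The stress tensor `S_g = (Dg + Dgᵀ)/2` applied to `curl g`:
`(S_g curl g)_i = Σ_j ((∂_j g_i + ∂_i g_j)/2) (curl g)_j`. -/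
def stressCurl (g : E3 → E3) (x : E3) (i : Fin 3) : ℝ :=
  ∑ j : Fin 3, (1 / 2) * (pd g j i x + pd g i j x) * curl g x j

/-- The convective derivative of the curl: `((g·∇) curl g)_i = Σ_j g_j ∂_j (curl g)_i`. -/
def convCurl (g : E3 → E3) (x : E3) (i : Fin 3) : ℝ :=
  ∑ j : Fin 3, g x j * fderiv ℝ (fun y => curl g y i) x (EuclideanSpace.single j 1)

/-- The unit cube `[0,1]³`. -/
def box : Set E3 := {x : E3 | ∀ i, x i ∈ Set.Icc (0 : ℝ) 1}

/-- The `k`-th partial derivative of a scalar function on `ℝ³`. -/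
def pderiv (k : Fin 3) (φ : E3 → ℝ) (x : E3) : ℝ :=
  fderiv ℝ φ x (EuclideanSpace.single k 1)

section pderiv

variable {φ ψ : E3 → ℝ} {k : Fin 3} {x : E3}

lemma pderiv_add (hφ : DifferentiableAt ℝ φ x) (hψ : DifferentiableAt ℝ ψ x) :
    pderiv k (fun y => φ y + ψ y) x = pderiv k φ x + pderiv k ψ x := by
  simp [pderiv, fderiv_fun_add hφ hψ]

lemma pderiv_sub (hφ : DifferentiableAt ℝ φ x) (hψ : DifferentiableAt ℝ ψ x) :
    pderiv k (fun y => φ y - ψ y) x = pderiv k φ x - pderiv k ψ x := by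
  simp [pderiv, fderiv_fun_sub hφ hψ]

lemma pderiv_mul (hφ : DifferentiableAt ℝ φ x) (hψ : DifferentiableAt ℝ ψ x) :
    pderiv k (fun y => φ y * ψ y) x = φ x * pderiv k ψ x + ψ x * pderiv k φ x := by
  simp [pderiv, fderiv_fun_mul hφ hψ]

lemma ContDiff.pderiv {m n : WithTop ℕ∞} (hφ : ContDiff ℝ n φ) (hmn : m + 1 ≤ n) (k : Fin 3) :
    ContDiff ℝ m (pderiv k φ) :=
  (hφ.fderiv_right hmn).clm_apply contDiff_const

lemma pderiv_comm (hφ : ContDiff ℝ 2 φ) (j k : Fin 3) (x : E3) :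
    pderiv j (pderiv k φ) x = pderiv k (pderiv j φ) x := by
  have key (i l : Fin 3) : pderiv i (pderiv l φ) x =
      fderiv ℝ (fderiv ℝ φ) x (EuclideanSpace.single i 1) (EuclideanSpace.single l 1) := by
    have h : DifferentiableAt ℝ (fderiv ℝ φ) x :=
      (hφ.fderiv_right (m := 1) (by norm_num)).differentiable one_ne_zero x
    change fderiv ℝ (fun y => fderiv ℝ φ y (EuclideanSpace.single l 1)) x _ = _
    rw [fderiv_clm_apply h (differentiableAt_const _)]
    simp
  rw [key, key]
  exact (hφ.contDiffAt.isSymmSndFDerivAt (by simp)) _ _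

lemma pderiv_periodic {c : E3} (h : ∀ y, φ (y + c) = φ y) (k : Fin 3) (x : E3) :
    pderiv k φ (x + c) = pderiv k φ x := by
  have : (fun y => φ (y + c)) = φ := funext h
  rw [pderiv, pderiv, ← fderiv_comp_add_right, this]

end pderiv

lemma pd_eq_pderiv {v : E3 → E3} (hv : Differentiable ℝ v) (j i : Fin 3) :
    pd v j i = pderiv j (fun y => v y i) := by
  ext x
  have h := ((EuclideanSpace.proj (𝕜 := ℝ) i).hasFDerivAt.comp x (hv x).hasFDerivAt).fderiv
  change _ = fderiv ℝ (EuclideanSpace.proj (𝕜 := ℝ) i ∘ v) x _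
  rw [h]
  rfl

lemma box_eq_preimage : box = WithLp.ofLp ⁻¹' Set.Icc (0 : Fin 3 → ℝ) 1 := by
  ext x
  simp [box, Pi.le_def, forall_and]

lemma isCompact_box : IsCompact box := by
  have h : box = (EuclideanSpace.equiv (Fin 3) ℝ).toHomeomorph ⁻¹' Set.Icc (0 : Fin 3 → ℝ) 1 :=
    box_eq_preimage
  rw [h, Homeomorph.isCompact_preimage]
  exact isCompact_Icc

/-- The divergence of a periodic `C¹` vector field has zero integral over the unit cube. -/
lemma integral_box_divergence_eq_zero (H : Fin 3 → E3 → ℝ) (hH : ∀ i, ContDiff ℝ 1 (H i))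
    (hper : ∀ i x, H i (x + EuclideanSpace.single i 1) = H i x) :
    ∫ x in box, ∑ i, pderiv i (H i) x = 0 := by
  let L : (Fin 3 → ℝ) →L[ℝ] E3 := (EuclideanSpace.equiv (Fin 3) ℝ).symm
  have hcont : Continuous fun x => ∑ i, pderiv i (H i) (L x) :=
    continuous_finsetSum _ fun i _ =>
      ((hH i).pderiv (m := 0) (by norm_num) i).continuous.comp L.continuous
  have hL (i : Fin 3) : L (Pi.single i 1) = EuclideanSpace.single i 1 := rfl
  have hdiv := integral_divergence_of_hasFDerivAt_off_countable (n := 2) (E := ℝ)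
    (0 : Fin 3 → ℝ) 1 zero_le_one (fun x i => H i (L x))
    (fun x => ContinuousLinearMap.pi fun i => (fderiv ℝ (H i) (L x)).comp L)
    ∅ Set.countable_empty
    (continuous_pi fun i => (hH i).continuous.comp L.continuous).continuousOn
    (fun x _ => hasFDerivAt_pi.2 fun i =>
      (((hH i).differentiable one_ne_zero (L x)).hasFDerivAt).comp x L.hasFDerivAt)
    (hcont.continuousOn.integrableOn_compact isCompact_Icc)
  have hface (i : Fin 3) (y : Fin 2 → ℝ) :
      H i (L (i.insertNth 1 y)) = H i (L (i.insertNth 0 y)) := by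
    have : (i.insertNth 1 y : Fin 3 → ℝ) = i.insertNth 0 y + Pi.single i 1 := by
      rw [← Fin.insertNth_zero_right, ← Fin.insertNth_add]
      simp
    rw [this, map_add, hL, hper]
  have hzero : ∫ x in Set.Icc (0 : Fin 3 → ℝ) 1, ∑ i, pderiv i (H i) (L x) = 0 := by
    refine Eq.trans hdiv (Finset.sum_eq_zero fun i _ => ?_)
    simp [hface]
  rw [box_eq_preimage, ← hzero]
  have hvol := EuclideanSpace.volume_preserving_symm_measurableEquiv_toLp (Fin 3)
  exact hvol.setIntegral_preimage_emb
    (MeasurableEquiv.measurableEmbedding _) (fun x => ∑ i, pderiv i (H i) (L x)) _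

/-- Integrands differing by the divergence of a periodic field have the same integral. -/
lemma integral_box_eq_of_eq_add_divergence {A B : E3 → ℝ} (hB : Continuous B) (H : Fin 3 → E3 → ℝ)
    (hH : ∀ i, ContDiff ℝ 1 (H i))
    (hper : ∀ i x, H i (x + EuclideanSpace.single i 1) = H i x)
    (h : ∀ x, A x = B x + ∑ i, pderiv i (H i) x) :
    ∫ x in box, A x = ∫ x in box, B x := by
  have hcont : Continuous fun x => ∑ i, pderiv i (H i) x :=
    continuous_finsetSum _ fun i _ => ((hH i).pderiv (m := 0) (by norm_num) i).continuous
  simp_rw [h]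
  rw [integral_add (hB.continuousOn.integrableOn_compact isCompact_box)
    (hcont.continuousOn.integrableOn_compact isCompact_box),
    integral_box_divergence_eq_zero H hH hper, add_zero]

section VectorField

variable {v : E3 → E3}

lemma contDiff_pd {m n : WithTop ℕ∞} (hv : ContDiff ℝ n v) (hmn : m + 1 ≤ n) (j i : Fin 3) :
    ContDiff ℝ m (pd v j i) :=
  contDiff_euclidean.1 ((hv.fderiv_right hmn).clm_apply contDiff_const) i

lemma contDiff_curl {m n : WithTop ℕ∞} (hv : ContDiff ℝ n v) (hmn : m + 1 ≤ n) (i : Fin 3) :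
    ContDiff ℝ m fun x => curl v x i := by
  have h := contDiff_pd hv hmn
  fin_cases i
  exacts [(h 1 2).sub (h 2 1), (h 2 0).sub (h 0 2), (h 0 1).sub (h 1 0)]

lemma contDiff_conv {m n : WithTop ℕ∞} (hv : ContDiff ℝ n v) (hmn : m + 1 ≤ n) (i : Fin 3) :
    ContDiff ℝ m fun x => conv v x i :=
  ContDiff.sum fun j _ => (contDiff_euclidean.1 (hv.of_le (le_self_add.trans hmn)) j).mul
    (contDiff_pd hv hmn j i)

lemma continuous_stressCurl (hv : ContDiff ℝ 1 v) (i : Fin 3) :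
    Continuous fun x => stressCurl v x i := by
  have h := fun j i => (contDiff_pd (m := 0) hv (by norm_num) j i).continuous
  have hc := fun j => (contDiff_curl (m := 0) hv (by norm_num) j).continuous
  exact continuous_finsetSum _ fun j _ =>
    (continuous_const.mul ((h j i).add (h i j))).mul (hc j)

lemma continuous_convCurl (hv : ContDiff ℝ 2 v) (i : Fin 3) :
    Continuous fun x => convCurl v x i := by
  have hc := (contDiff_curl (m := 1) hv (by norm_num) i).pderiv (m := 0) (by norm_num)
  exact continuous_finsetSum _ fun j _ =>
    (contDiff_euclidean.1 hv j).continuous.mul (hc j).continuous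

lemma pd_periodic {c : E3} (h : ∀ y, v (y + c) = v y) (j i : Fin 3) (x : E3) :
    pd v j i (x + c) = pd v j i x := by
  have : (fun y => v (y + c)) = v := funext h
  rw [pd, pd, ← fderiv_comp_add_right, this]

lemma curl_periodic {c : E3} (h : ∀ y, v (y + c) = v y) (x : E3) :
    curl v (x + c) = curl v x := by
  simp only [curl, pd_periodic h]

lemma conv_periodic {c : E3} (h : ∀ y, v (y + c) = v y) (x : E3) :
    conv v (x + c) = conv v x := by
  ext i
  simp only [conv, pd_periodic h, h]

lemma pderiv_pd_comm (hv : ContDiff ℝ 2 v) (k j i : Fin 3) (x : E3) :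
    pderiv k (pd v j i) x = pderiv j (pd v k i) x := by
  simp only [pd_eq_pderiv (hv.differentiable two_ne_zero)]
  exact pderiv_comm (contDiff_euclidean.1 hv i) k j x

lemma pderiv_curl (hv : ContDiff ℝ 2 v) (k : Fin 3) (x : E3) :
    (pderiv k (fun y => curl v y 0) x = pderiv k (pd v 1 2) x - pderiv k (pd v 2 1) x) ∧
    (pderiv k (fun y => curl v y 1) x = pderiv k (pd v 2 0) x - pderiv k (pd v 0 2) x) ∧
    (pderiv k (fun y => curl v y 2) x = pderiv k (pd v 0 1) x - pderiv k (pd v 1 0) x) := by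
  have h (j i : Fin 3) : DifferentiableAt ℝ (pd v j i) x :=
    (contDiff_pd (m := 1) hv (by norm_num) j i).differentiable one_ne_zero x
  exact ⟨pderiv_sub (h 1 2) (h 2 1), pderiv_sub (h 2 0) (h 0 2), pderiv_sub (h 0 1) (h 1 0)⟩

lemma pderiv_conv (hv : ContDiff ℝ 2 v) (k i : Fin 3) (x : E3) :
    pderiv k (fun y => conv v y i) x =
      ∑ j, (v x j * pderiv k (pd v j i) x + pd v j i x * pd v k j x) := by
  have hd (j : Fin 3) : DifferentiableAt ℝ (pd v j i) x :=
    (contDiff_pd (m := 1) hv (by norm_num) j i).differentiable one_ne_zero x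
  have hc (j : Fin 3) : DifferentiableAt ℝ (fun y => v y j) x :=
    (contDiff_euclidean.1 hv j).differentiable two_ne_zero x
  simp only [conv, Fin.sum_univ_three, pd_eq_pderiv (hv.differentiable two_ne_zero)] at hd ⊢
  rw [pderiv_add (((hc 0).fun_mul (hd 0)).fun_add ((hc 1).fun_mul (hd 1))) ((hc 2).fun_mul (hd 2)),
    pderiv_add ((hc 0).fun_mul (hd 0)) ((hc 1).fun_mul (hd 1)), pderiv_mul (hc 0) (hd 0),
    pderiv_mul (hc 1) (hd 1), pderiv_mul (hc 2) (hd 2)]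

/-- Every derivative of the divergence of a divergence-free field vanishes. -/
lemma sum_pderiv_pd_self_eq_zero (hv : ContDiff ℝ 2 v) (hdiv : ∀ x, ∑ j, pd v j j x = 0)
    (k : Fin 3) (x : E3) : ∑ j, pderiv k (pd v j j) x = 0 := by
  have h (j : Fin 3) : DifferentiableAt ℝ (pd v j j) x :=
    (contDiff_pd (m := 1) hv (by norm_num) j j).differentiable one_ne_zero x
  simp only [Fin.sum_univ_three] at hdiv ⊢
  rw [← pderiv_add (h 0) (h 1), ← pderiv_add ((h 0).fun_add (h 1)) (h 2), funext hdiv]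
  simp [pderiv]

end VectorField

/-- The cross product `((g·∇)g) × curl f`, as a family of scalar components. -/
def convCrossCurl (f g : E3 → E3) (i : Fin 3) (x : E3) : ℝ :=
  conv g x (i + 1) * curl f x (i + 2) - conv g x (i + 2) * curl f x (i + 1)

lemma contDiff_convCrossCurl {f g : E3 → E3} (hf : ContDiff ℝ 2 f) (hg : ContDiff ℝ 2 g)
    (i : Fin 3) : ContDiff ℝ 1 (convCrossCurl f g i) := by
  have hu := contDiff_conv (m := 1) hg (by norm_num)
  have hw := contDiff_curl (m := 1) hf (by norm_num)
  exact ((hu _).mul (hw _)).sub ((hu _).mul (hw _))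

lemma convCrossCurl_periodic {f g : E3 → E3} {c : E3} (hf : ∀ y, f (y + c) = f y)
    (hg : ∀ y, g (y + c) = g y) (i : Fin 3) (x : E3) :
    convCrossCurl f g i (x + c) = convCrossCurl f g i x := by
  simp only [convCrossCurl, curl_periodic hf, conv_periodic hg]

/-- `Δf · ((g·∇)g) = curl f · (S_g curl g - (g·∇) curl g) + div (((g·∇)g) × curl f)` for
divergence-free `f` and `g`. -/
lemma lap_mul_conv_eq {f g : E3 → E3} (hf : ContDiff ℝ 2 f) (hg : ContDiff ℝ 2 g)
    (hfdiv : ∀ x, ∑ j, pd f j j x = 0) (hgdiv : ∀ x, ∑ j, pd g j j x = 0) (x : E3) :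
    ∑ i, lap f x i * conv g x i =
      ∑ i, curl f x i * (stressCurl g x i - convCurl g x i) +
        ∑ i, pderiv i (convCrossCurl f g i) x := by
  have hu (i : Fin 3) : DifferentiableAt ℝ (fun y => conv g y i) x :=
    (contDiff_conv (m := 1) hg (by norm_num) i).differentiable one_ne_zero x
  have hw (i : Fin 3) : DifferentiableAt ℝ (fun y => curl f y i) x :=
    (contDiff_curl (m := 1) hf (by norm_num) i).differentiable one_ne_zero x
  have hcross (i : Fin 3) : pderiv i (convCrossCurl f g i) x =
      (conv g x (i + 1) * pderiv i (fun y => curl f y (i + 2)) x +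
        curl f x (i + 2) * pderiv i (fun y => conv g y (i + 1)) x) -
      (conv g x (i + 2) * pderiv i (fun y => curl f y (i + 1)) x +
        curl f x (i + 1) * pderiv i (fun y => conv g y (i + 2)) x) := by
    rw [← pderiv_mul (hu _) (hw _), ← pderiv_mul (hu _) (hw _),
      ← pderiv_sub ((hu _).fun_mul (hw _)) ((hu _).fun_mul (hw _))]
    rfl
  have hlap (i : Fin 3) : lap f x i = ∑ j, pderiv j (pd f j i) x := rfl
  have hconvCurl (i : Fin 3) :
      convCurl g x i = ∑ j, g x j * pderiv j (fun y => curl g y i) x := rfl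
  have hcg (k : Fin 3) := pderiv_curl hg k x
  have hcf (k : Fin 3) := pderiv_curl hf k x
  have hfd (k : Fin 3) := sum_pderiv_pd_self_eq_zero hf hfdiv k x
  have hgx := hgdiv x
  have hlapcurl : lap f x 0 = pderiv 2 (fun y => curl f y 1) x - pderiv 1 (fun y => curl f y 2) x ∧
      lap f x 1 = pderiv 0 (fun y => curl f y 2) x - pderiv 2 (fun y => curl f y 0) x ∧
      lap f x 2 = pderiv 1 (fun y => curl f y 0) x - pderiv 0 (fun y => curl f y 1) x := by
    simp only [Fin.sum_univ_three] at hfd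
    simp only [hlap, Fin.sum_univ_three, (hcf _).1, (hcf _).2.1, (hcf _).2.2]
    refine ⟨?_, ?_, ?_⟩
    · linear_combination hfd 0 + pderiv_pd_comm hf 2 0 2 x + pderiv_pd_comm hf 1 0 1 x
    · linear_combination hfd 1 + pderiv_pd_comm hf 0 1 0 x + pderiv_pd_comm hf 2 1 2 x
    · linear_combination hfd 2 + pderiv_pd_comm hf 0 2 0 x + pderiv_pd_comm hf 1 2 1 x
  have hcurlconv (a b : Fin 3) :
      pderiv a (fun y => conv g y b) x - pderiv b (fun y => conv g y a) x =
      ∑ j, (g x j * (pderiv j (pd g a b) x - pderiv j (pd g b a) x) +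
        (pd g j b x * pd g a j x - pd g j a x * pd g b j x)) := by
    rw [pderiv_conv hg, pderiv_conv hg, ← Finset.sum_sub_distrib]
    refine Finset.sum_congr rfl fun j _ => ?_
    linear_combination g x j * (pderiv_pd_comm hg a j b x - pderiv_pd_comm hg b j a x)
  have h12 := hcurlconv 1 2
  have h20 := hcurlconv 2 0
  have h01 := hcurlconv 0 1
  obtain ⟨hl0, hl1, hl2⟩ := hlapcurl
  have e0 : (0 : Fin 3) + 1 = 1 := rfl
  have e1 : (1 : Fin 3) + 1 = 2 := rfl
  have e2 : (2 : Fin 3) + 1 = 0 := rfl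
  have e3 : (0 : Fin 3) + 2 = 2 := rfl
  have e4 : (1 : Fin 3) + 2 = 0 := rfl
  have e5 : (2 : Fin 3) + 2 = 1 := rfl
  have hg0 : curl g x 0 = pd g 1 2 x - pd g 2 1 x := rfl
  have hg1 : curl g x 1 = pd g 2 0 x - pd g 0 2 x := rfl
  have hg2 : curl g x 2 = pd g 0 1 x - pd g 1 0 x := rfl
  simp only [hcross, hconvCurl, stressCurl, Fin.sum_univ_three, e0, e1, e2, e3, e4, e5,
    (hcg _).1, (hcg _).2.1, (hcg _).2.2, hl0, hl1, hl2, hg0, hg1, hg2] at h12 h20 h01 hgx ⊢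
  linear_combination -(curl f x 0) * h12 - curl f x 1 * h20 - curl f x 2 * h01 -
    (curl f x 0 * (pd g 1 2 x - pd g 2 1 x) + curl f x 1 * (pd g 2 0 x - pd g 0 2 x) +
      curl f x 2 * (pd g 0 1 x - pd g 1 0 x)) * hgx

/-- For divergence-free `f`, the field `|curl f|² f` has divergence
`2 curl f · ((f·∇) curl f)`. -/
lemma sum_pderiv_sq_curl_mul {f : E3 → E3} (hf : ContDiff ℝ 2 f)
    (hfdiv : ∀ x, ∑ j, pd f j j x = 0) (x : E3) :
    ∑ j, pderiv j (fun y => (∑ i, curl f y i * curl f y i) * f y j) x =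
      2 * ∑ i, curl f x i * convCurl f x i := by
  have hw (i : Fin 3) : DifferentiableAt ℝ (fun y => curl f y i) x :=
    (contDiff_curl (m := 1) hf (by norm_num) i).differentiable one_ne_zero x
  have hc (j : Fin 3) : DifferentiableAt ℝ (fun y => f y j) x :=
    (contDiff_euclidean.1 hf j).differentiable two_ne_zero x
  have hq (i : Fin 3) : DifferentiableAt ℝ (fun y => curl f y i * curl f y i) x :=
    (hw i).mul (hw i)
  have hsum (j : Fin 3) : pderiv j (fun y => ∑ i, curl f y i * curl f y i) x =
      2 * ∑ i, curl f x i * pderiv j (fun y => curl f y i) x := by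
    simp only [Fin.sum_univ_three]
    rw [pderiv_add ((hq 0).fun_add (hq 1)) (hq 2), pderiv_add (hq 0) (hq 1),
      pderiv_mul (hw 0) (hw 0), pderiv_mul (hw 1) (hw 1), pderiv_mul (hw 2) (hw 2)]
    ring
  have hprod (j : Fin 3) :
      pderiv j (fun y => (∑ i, curl f y i * curl f y i) * f y j) x =
      (∑ i, curl f x i * curl f x i) * pd f j j x +
        f x j * (2 * ∑ i, curl f x i * pderiv j (fun y => curl f y i) x) := by
    rw [pderiv_mul (DifferentiableAt.fun_sum fun i _ => hq i) (hc j), hsum,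
      pd_eq_pderiv (hf.differentiable two_ne_zero)]
  have hconvCurl (i : Fin 3) :
      convCurl f x i = ∑ j, f x j * pderiv j (fun y => curl f y i) x := rfl
  have hfx := hfdiv x
  simp only [hprod, hconvCurl]
  simp only [Fin.sum_univ_three] at hfx ⊢
  linear_combination (curl f x 0 * curl f x 0 + curl f x 1 * curl f x 1 +
    curl f x 2 * curl f x 2) * hfx

/-- **Statement 14.** For smooth 1-periodic divergence-free fields `f, g : ℝ³ → ℝ³`,
`∫ Δf · ((g·∇)g) = ∫ curl f · (S_g curl g - (g·∇) curl g)`; in particular, for `f = g`,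
`∫ Δf · ((f·∇)f) = ∫ ⟨S_f curl f, curl f⟩` (the integrated vortex stretching). -/
theorem stmt14 (f g : E3 → E3)
    (hf : ContDiff ℝ (⊤ : ℕ∞) f) (hg : ContDiff ℝ (⊤ : ℕ∞) g)
    (hfper : ∀ (x : E3) (i : Fin 3), f (x + EuclideanSpace.single i 1) = f x)
    (hgper : ∀ (x : E3) (i : Fin 3), g (x + EuclideanSpace.single i 1) = g x)
    (hfdiv : ∀ x : E3, (∑ j : Fin 3, pd f j j x) = 0)
    (hgdiv : ∀ x : E3, (∑ j : Fin 3, pd g j j x) = 0) :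
    (∫ x in box, (∑ i : Fin 3, lap f x i * conv g x i)) =
      (∫ x in box, (∑ i : Fin 3, curl f x i * (stressCurl g x i - convCurl g x i))) ∧
    (∫ x in box, (∑ i : Fin 3, lap f x i * conv f x i)) =
      ∫ x in box, (∑ i : Fin 3, stressCurl f x i * curl f x i) := by
  have hf2 : ContDiff ℝ 2 f := contDiff_infty.1 hf 2
  have hg2 : ContDiff ℝ 2 g := contDiff_infty.1 hg 2
  have hwc (i : Fin 3) : ContDiff ℝ 1 fun x => curl f x i :=
    contDiff_curl hf2 (by norm_num) i
  constructor
  · refine integral_box_eq_of_eq_add_divergence (continuous_finsetSum _ fun i _ =>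
      (hwc i).continuous.mul ((continuous_stressCurl (hg2.of_le (by norm_num)) i).sub
        (continuous_convCurl hg2 i))) (convCrossCurl f g) (contDiff_convCrossCurl hf2 hg2)
      (fun i x => convCrossCurl_periodic (hfper · i) (hgper · i) i x)
      (lap_mul_conv_eq hf2 hg2 hfdiv hgdiv)
  · have hq (i : Fin 3) : ContDiff ℝ 1 fun y => (∑ k, curl f y k * curl f y k) * f y i :=
      (ContDiff.sum fun k _ => (hwc k).mul (hwc k)).mul
        (contDiff_euclidean.1 (hf2.of_le (by norm_num)) i)
    refine integral_box_eq_of_eq_add_divergence (continuous_finsetSum _ fun i _ =>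
      (continuous_stressCurl (hf2.of_le (by norm_num)) i).mul (hwc i).continuous)
      (fun i x => convCrossCurl f f i x -
        1 / 2 * ((∑ k, curl f x k * curl f x k) * f x i))
      (fun i => (contDiff_convCrossCurl hf2 hf2 i).sub (contDiff_const.mul (hq i)))
      (fun i x => ?_) (fun x => ?_)
    · simp only [convCrossCurl_periodic (hfper · i) (hfper · i), curl_periodic (hfper · i), hfper]
    · have hsub (i : Fin 3) : pderiv i (fun x => convCrossCurl f f i x -
          1 / 2 * ((∑ k, curl f x k * curl f x k) * f x i)) x =
          pderiv i (convCrossCurl f f i) x -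
            1 / 2 * pderiv i (fun y => (∑ k, curl f y k * curl f y k) * f y i) x := by
        have hd := (hq i).differentiable one_ne_zero x
        rw [pderiv_sub ((contDiff_convCrossCurl hf2 hf2 i).differentiable one_ne_zero x)
          ((differentiableAt_const _).fun_mul hd), pderiv_mul (differentiableAt_const _) hd]
        simp [pderiv]
      simp_rw [hsub, Finset.sum_sub_distrib, ← Finset.mul_sum]
      rw [sum_pderiv_sq_curl_mul hf2 hfdiv, lap_mul_conv_eq hf2 hf2 hfdiv hfdiv]
      simp only [Fin.sum_univ_three]
      ring
end
end
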